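/- There exists N ∈ ℕ such that for every n ≥ N, the set of integers k ≥ 2 with f(n,k) ≥ ⌈kH_n⌉ + 1 is infinite, where H_n = ∑_{i=1}^n 1/i. -/

import Mathlib

open scoped Classical in
/-- `coverNumber n k` is the minimum size of a multiset `C` of coefficient vectors
`c ∈ ℝ^n` (each representing the hyperplane `{x : ∑ i, c i * x i = 1}`, which avoids
the origin) such that every nonzero point `x ∈ {0,1}^n` lies on at least `k` of the
hyperplanes, counted with multiplicity. -/
noncomputable def coverNumber (n k : ℕ) : ℕ :=
  sInf {m | ∃ C : Multiset (Fin n → ℝ),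
    Multiset.card C = m ∧
    ∀ x : Fin n → ℝ, (∀ i, x i = 0 ∨ x i = 1) → x ≠ 0 →
      k ≤ Multiset.card (C.filter (fun c => ∑ i, c i * x i = 1))}

/-- The `n`-th harmonic number, as a real number. -/
noncomputable def harmonicR (n : ℕ) : ℝ := ∑ i ∈ Finset.range n, 1 / ((i : ℝ) + 1)

theorem factorial_mul_factorial_dvd_lcmUpto_mul (m : ℕ) :
    (6 * m).factorial * m.factorial ∣
      Nat.lcmUpto (6 * m) * ((3 * m).factorial * ((2 * m).factorial * (2 * m).factorial)) := by
  have hf := Nat.factorial_ne_zero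
  have hl := Nat.lcmUpto_ne_zero (6 * m)
  rw [← Nat.factorization_prime_le_iff_dvd (mul_ne_zero (hf _) (hf _))
    (mul_ne_zero hl (mul_ne_zero (hf _) (mul_ne_zero (hf _) (hf _))))]
  intro p hp
  rw [Nat.factorization_mul (hf _) (hf _), Nat.factorization_mul hl
    (mul_ne_zero (hf _) (mul_ne_zero (hf _) (hf _))),
    Nat.factorization_mul (hf _) (mul_ne_zero (hf _) (hf _)),
    Nat.factorization_mul (hf _) (hf _)]
  simp only [Finsupp.add_apply, Nat.factorization_lcmUpto _ hp]
  have hlog : ∀ j, j ≤ 6 * m → Nat.log p j < Nat.log p (6 * m) + 1 := fun j hj =>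
    Nat.lt_succ_of_le (Nat.log_mono_right hj)
  rw [Nat.factorization_factorial hp (hlog (6 * m) le_rfl),
    Nat.factorization_factorial hp (hlog m (by omega)),
    Nat.factorization_factorial hp (hlog (3 * m) (by omega)),
    Nat.factorization_factorial hp (hlog (2 * m) (by omega))]
  have hcard : Nat.log p (6 * m) = ∑ i ∈ Finset.Ico 1 (Nat.log p (6 * m) + 1), 1 := by simp
  simp only [← Finset.sum_add_distrib]
  conv_rhs => enter [1]; rw [hcard]
  rw [← Finset.sum_add_distrib]
  apply Finset.sum_le_sum
  intro i _
  have hq : 0 < p ^ i := pow_pos hp.pos i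
  generalize p ^ i = q at hq
  obtain ⟨a, r, hr, rfl⟩ : ∃ a r, r < q ∧ m = q * a + r :=
    ⟨m / q, m % q, Nat.mod_lt _ hq, (Nat.div_add_mod m q).symm⟩
  have key : ∀ t, (t * (q * a + r)) / q = t * a + (t * r) / q := fun t => by
    rw [show t * (q * a + r) = t * r + q * (t * a) by ring, Nat.add_mul_div_left _ _ hq, add_comm]
  have h1 := key 1
  rw [one_mul, one_mul, one_mul, Nat.div_eq_of_lt hr] at h1
  rw [key 6, key 3, key 2, h1]
  have d6 := Nat.div_add_mod (6 * r) q
  have d3 := Nat.div_add_mod (3 * r) q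
  have d2 := Nat.div_add_mod (2 * r) q
  have m6 := Nat.mod_lt (6 * r) hq
  have m3 := Nat.mod_lt (3 * r) hq
  have m2 := Nat.mod_lt (2 * r) hq
  have b6 : 6 * r / q < 6 := by rw [Nat.div_lt_iff_lt_mul hq]; omega
  have b3 : 3 * r / q < 3 := by rw [Nat.div_lt_iff_lt_mul hq]; omega
  have b2 : 2 * r / q < 2 := by rw [Nat.div_lt_iff_lt_mul hq]; omega
  generalize 6 * r / q = x at *
  generalize 3 * r / q = y at *
  generalize 2 * r / q = z at *
  interval_cases x <;> interval_cases y <;> interval_cases z <;> omega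

theorem pow_mul_factorial_le (m : ℕ) (hm : 4 ≤ m) :
    96 ^ m * ((3 * m).factorial * ((2 * m).factorial * (2 * m).factorial)) ≤
      96 ^ 4 * ((6 * m).factorial * m.factorial) := by
  induction m, hm using Nat.le_induction with
  | base => norm_num [Nat.factorial]
  | succ m hm ih =>
    have e6 : (6 * (m + 1)).factorial = (6*m+6)*((6*m+5)*((6*m+4)*((6*m+3)*((6*m+2)*((6*m+1)
      * (6*m).factorial))))) := by
      rw [show 6 * (m + 1) = 6 * m + 5 + 1 by ring]; simp only [Nat.factorial_succ]
    have e3 : (3 * (m + 1)).factorial = (3*m+3)*((3*m+2)*((3*m+1) * (3*m).factorial)) := by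
      rw [show 3 * (m + 1) = 3 * m + 2 + 1 by ring]; simp only [Nat.factorial_succ]
    have e2 : (2 * (m + 1)).factorial = (2*m+2)*((2*m+1) * (2*m).factorial) := by
      rw [show 2 * (m + 1) = 2 * m + 1 + 1 by ring]; simp only [Nat.factorial_succ]
    rw [e6, e3, e2, Nat.factorial_succ m, pow_succ]
    generalize (6*m).factorial = A at *
    generalize (3*m).factorial = B at *
    generalize (2*m).factorial = C at *
    generalize m.factorial = D at *
    have hc : 96 * ((2*m+1)*(m+1)) ≤ 6 * ((6*m+1)*(6*m+5)) := by nlinarith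
    calc _ = (96 ^ m * (B * (C * C))) * ((3*m+3)*(3*m+2)*(3*m+1)*(2*m+2)*(2*m+1)*2) *
          (96 * ((2*m+1)*(m+1))) := by ring
      _ ≤ (96 ^ 4 * (A * D)) * ((3*m+3)*(3*m+2)*(3*m+1)*(2*m+2)*(2*m+1)*2) *
          (6 * ((6*m+1)*(6*m+5))) := by gcongr
      _ = _ := by ring

theorem psi_ge_mul_log_ninety_six (n : ℕ) :
    ((n : ℝ) / 6 - 5) * Real.log 96 ≤ Chebyshev.psi n := by
  have hlog : 0 < Real.log 96 := Real.log_pos (by norm_num)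
  rcases lt_or_ge (n / 6) 4 with h | h
  · have : (n : ℝ) ≤ 30 := by exact_mod_cast (by omega : n ≤ 30)
    refine le_trans ?_ (Chebyshev.psi_nonneg _)
    exact mul_nonpos_of_nonpos_of_nonneg (by linarith) hlog.le
  · set m := n / 6 with hm
    have h1 : ((6 * m : ℕ) : ℝ) ≤ n := by exact_mod_cast (by omega : 6 * m ≤ n)
    have h2 : (n : ℝ) ≤ 6 * m + 6 := by exact_mod_cast (by omega : n ≤ 6 * m + 6)
    refine le_trans ?_ (Chebyshev.psi_mono h1)
    rw [Chebyshev.psi_eq_log_lcmUpto]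
    have hP : 0 < (3 * m).factorial * ((2 * m).factorial * (2 * m).factorial) := by positivity
    have h3 : 96 ^ m ≤ 96 ^ 4 * Nat.lcmUpto (6 * m) := by
      refine Nat.le_of_mul_le_mul_right ?_ hP
      refine (pow_mul_factorial_le m h).trans ?_
      rw [mul_assoc]
      exact Nat.mul_le_mul_left _ (Nat.le_of_dvd (Nat.mul_pos (Nat.lcmUpto_pos _) hP)
        (factorial_mul_factorial_dvd_lcmUpto_mul m))
    have h4 : (96 : ℝ) ^ m ≤ 96 ^ 4 * (Nat.lcmUpto (6 * m) : ℝ) := by exact_mod_cast h3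
    have hl : (0 : ℝ) < Nat.lcmUpto (6 * m) := by exact_mod_cast Nat.lcmUpto_pos _
    have h5 := Real.log_le_log (by positivity) h4
    rw [Real.log_mul (by positivity) hl.ne', Real.log_pow, Real.log_pow] at h5
    push_cast at h5
    nlinarith

theorem prime_dvd_harmonic_den {n p M : ℕ} (hp : p.Prime) (hpn : p ≤ n) (hM : n < p * M)
    (hpM : M * M.factorial < p) : p ∣ (harmonic n).den := by
  by_contra hdvd
  have := Fact.mk hp
  have hmM : n / p < M := Nat.div_lt_of_lt_mul hM
  have hm0 : 0 < n / p := Nat.div_pos hpn hp.pos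
  set m := n / p with hm
  have hH : ‖((harmonic n : ℚ) : ℚ_[p])‖ ≤ 1 := Padic.norm_rat_le_one hdvd
  have hsum : ((harmonic n : ℚ) : ℚ_[p]) = ∑ i ∈ Finset.Icc 1 n, ((i : ℚ_[p]))⁻¹ := by
    rw [harmonic_eq_sum_Icc]; push_cast; rfl
  rw [hsum, ← Finset.sum_filter_add_sum_filter_not _ (fun i => p ∣ i)] at hH
  have hnot : ‖∑ i ∈ (Finset.Icc 1 n).filter (fun i => ¬ p ∣ i), ((i : ℚ_[p]))⁻¹‖ ≤ 1 := by
    refine IsUltrametricDist.norm_sum_le_of_forall_le_of_nonneg zero_le_one fun i hi => ?_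
    rw [norm_inv, Padic.norm_natCast_eq_one_iff.2 ((hp.coprime_iff_not_dvd).2
      (Finset.mem_filter.1 hi).2), inv_one]
  have hdiv : ‖∑ i ∈ (Finset.Icc 1 n).filter (fun i => p ∣ i), ((i : ℚ_[p]))⁻¹‖ ≤ 1 := by
    have := (IsUltrametricDist.norm_add_le_max _ _).trans (max_le hH ((norm_neg _).trans_le hnot))
    simpa using this
  have hre : ∑ i ∈ (Finset.Icc 1 n).filter (fun i => p ∣ i), ((i : ℚ_[p]))⁻¹
      = (p : ℚ_[p])⁻¹ * ∑ j ∈ Finset.Icc 1 m, ((j : ℚ_[p]))⁻¹ := by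
    rw [Finset.mul_sum]
    refine Finset.sum_nbij' (fun i => i / p) (fun j => p * j) ?_ ?_ ?_ ?_ ?_
    · intro i hi
      simp only [Finset.mem_filter, Finset.mem_Icc] at hi ⊢
      exact ⟨Nat.div_pos (Nat.le_of_dvd (by omega) hi.2) hp.pos, Nat.div_le_div_right hi.1.2⟩
    · intro j hj
      simp only [Finset.mem_filter, Finset.mem_Icc] at hj ⊢
      exact ⟨⟨Nat.mul_pos hp.pos hj.1, (Nat.mul_le_mul_left p hj.2).trans (Nat.mul_div_le n p)⟩,
        dvd_mul_right p j⟩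
    · intro i hi
      exact Nat.mul_div_cancel' (Finset.mem_filter.1 hi).2
    · intro j _
      exact Nat.mul_div_cancel_left j hp.pos
    · intro i hi
      obtain ⟨j, rfl⟩ := (Finset.mem_filter.1 hi).2
      rw [Nat.mul_div_cancel_left j hp.pos]
      push_cast
      rw [mul_inv]
  set B := ∑ j ∈ Finset.Icc 1 m, m.factorial / j with hB
  have hBcast : (B : ℚ_[p]) = m.factorial * ∑ j ∈ Finset.Icc 1 m, ((j : ℚ_[p]))⁻¹ := by
    rw [hB, Finset.mul_sum]
    push_cast
    refine Finset.sum_congr rfl fun j hj => ?_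
    rw [Finset.mem_Icc] at hj
    rw [Nat.cast_div (Nat.dvd_factorial (by omega) hj.2) (by exact_mod_cast (by omega : j ≠ 0)),
      div_eq_mul_inv]
  have hBnorm : ‖(B : ℚ_[p])‖ < 1 := by
    have hp1 : (p : ℚ_[p]) ≠ 0 := by exact_mod_cast hp.ne_zero
    have : (B : ℚ_[p]) = m.factorial * (p * ((p : ℚ_[p])⁻¹ *
        ∑ j ∈ Finset.Icc 1 m, ((j : ℚ_[p]))⁻¹)) := by
      rw [hBcast]; field_simp
    rw [this, ← hre, norm_mul, norm_mul]
    have h1 : ‖(m.factorial : ℚ_[p])‖ ≤ 1 := by simpa using Padic.norm_int_le_one (p := p) m.factorial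
    have h2 : ‖(p : ℚ_[p])‖ < 1 := Padic.norm_p_lt_one
    calc _ ≤ 1 * (‖(p : ℚ_[p])‖ * 1) := by gcongr
      _ < 1 := by linarith
  have hpB : p ∣ B := by
    by_contra h
    exact hBnorm.ne (Padic.norm_natCast_eq_one_iff.2 ((hp.coprime_iff_not_dvd).2 h))
  have hBle : B ≤ M * M.factorial := by
    calc B ≤ ∑ j ∈ Finset.Icc 1 m, m.factorial :=
          Finset.sum_le_sum fun j _ => Nat.div_le_self _ _
      _ = m * m.factorial := by simp
      _ ≤ _ := Nat.mul_le_mul hmM.le (Nat.factorial_le hmM.le)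
  have hBpos : 0 < B := by
    refine lt_of_lt_of_le ?_ (Finset.single_le_sum (f := fun j => m.factorial / j)
      (fun _ _ => Nat.zero_le _) (Finset.mem_Icc.2 ⟨le_rfl, hm0⟩))
    simpa using m.factorial_pos
  exact absurd (Nat.le_of_dvd hBpos hpB) (by omega)

theorem theta_sub_theta_le_log_harmonic_den {n M : ℕ} (hM : 0 < M)
    (hn : M * (M * M.factorial) ≤ n) :
    Chebyshev.theta n - Chebyshev.theta (n / M : ℕ) ≤ Real.log (harmonic n).den := by
  set P := (Finset.Ioc (n / M) n).filter Nat.Prime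
  have hsplit : Chebyshev.theta n - Chebyshev.theta (n / M : ℕ) = ∑ p ∈ P, Real.log p := by
    simp only [Chebyshev.theta, Nat.floor_natCast]
    rw [sub_eq_iff_eq_add, add_comm, ← Finset.sum_union]
    · congr 1
      rw [← Finset.filter_union, Finset.Ioc_union_Ioc_eq_Ioc (Nat.zero_le _) (Nat.div_le_self _ _)]
    · rw [Finset.disjoint_left]
      intro a ha hb
      simp only [P, Finset.mem_filter, Finset.mem_Ioc] at ha hb
      omega
  have hdvd : ∏ p ∈ P, p ∣ (harmonic n).den := by
    refine Finset.prod_primes_dvd _ (fun p hp => (Finset.mem_filter.1 hp).2.prime) fun p hp => ?_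
    simp only [P, Finset.mem_filter, Finset.mem_Ioc] at hp
    refine prime_dvd_harmonic_den (M := M) hp.2 hp.1.2 ((Nat.div_lt_iff_lt_mul hM).1 hp.1.1) ?_
    exact lt_of_le_of_lt ((Nat.le_div_iff_mul_le hM).2 (by linarith)) hp.1.1
  rw [hsplit, ← Real.log_prod (fun p hp => by
    exact_mod_cast (Finset.mem_filter.1 hp).2.ne_zero)]
  have hpos : 0 < ∏ p ∈ P, p := Finset.prod_pos fun p hp => (Finset.mem_filter.1 hp).2.pos
  rw [← Nat.cast_prod]
  refine Real.log_le_log (by exact_mod_cast hpos) ?_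
  exact_mod_cast Nat.le_of_dvd (harmonic n).den_pos hdvd

open Filter in
theorem eventually_mul_two_pow_lt_harmonic_den :
    ∀ᶠ n : ℕ in atTop, n * 2 ^ n < (harmonic n).den := by
  have hl2 : 0 < Real.log 2 := Real.log_pos one_lt_two
  have h1 : Tendsto (fun x : ℝ => Real.log x / x ^ (1 / 2 : ℝ)) atTop (nhds 0) :=
    (isLittleO_log_rpow_atTop (by norm_num)).tendsto_div_nhds_zero
  have h2 : ∀ᶠ x : ℝ in atTop, Real.log x / x ^ (1 / 2 : ℝ) < Real.log 2 / 400 :=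
    h1.eventually_lt_const (by positivity)
  have h3 := tendsto_natCast_atTop_atTop (R := ℝ) |>.eventually h2
  have h4 := tendsto_natCast_atTop_atTop (R := ℝ) |>.eventually
    (eventually_ge_atTop (100000 * Real.log 96 / Real.log 2))
  filter_upwards [h3, h4, eventually_ge_atTop (32 * (32 * Nat.factorial 32)),
    eventually_ge_atTop 1] with n hn3 hn4 hnM hn1
  have hn0 : (1 : ℝ) ≤ n := by exact_mod_cast hn1
  have hs : 1 ≤ √(n : ℝ) := by rw [Real.one_le_sqrt]; exact hn0
  have hss : √(n : ℝ) * √(n : ℝ) = n := Real.mul_self_sqrt (by linarith)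
  rw [← Real.sqrt_eq_rpow, div_lt_iff₀ (by linarith)] at hn3
  rw [div_le_iff₀ hl2] at hn4
  have hA := theta_sub_theta_le_log_harmonic_den (by norm_num) hnM
  have hB := Chebyshev.theta_le_log4_mul_x (x := ((n / 32 : ℕ) : ℝ)) (by positivity)
  have hC := Chebyshev.psi_sub_theta_le (x := (n : ℝ)) hn0
  have hD := psi_ge_mul_log_ninety_six n
  have hlog4 : Real.log 4 = 2 * Real.log 2 := by
    rw [show (4 : ℝ) = 2 ^ 2 by norm_num, Real.log_pow]; norm_num
  have hlog96 : 13 * Real.log 2 ≤ 2 * Real.log 96 := by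
    have := Real.log_le_log (by norm_num) (show (2 : ℝ) ^ 13 ≤ 96 ^ 2 by norm_num)
    rw [Real.log_pow, Real.log_pow] at this
    exact_mod_cast this
  have hdiv : ((n / 32 : ℕ) : ℝ) ≤ n / 32 := by exact_mod_cast Nat.cast_div_le
  have hE : Real.log 4 * ((n / 32 : ℕ) : ℝ) ≤ 2 * Real.log 2 * (n / 32) := by
    rw [hlog4]; gcongr
  have hF : 2 * √(n : ℝ) * Real.log n ≤ 2 * (Real.log 2 / 400 * n) := by
    nlinarith
  have hG : Real.log n ≤ Real.log 2 / 400 * n := by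
    nlinarith
  have hH : (n : ℝ) / 6 * (13 / 2 * Real.log 2) ≤ n / 6 * Real.log 96 := by
    gcongr; linarith
  have hpos : (0 : ℝ) < n * Real.log 2 := by positivity
  have key : Real.log ((n : ℝ) * 2 ^ n) < Real.log (harmonic n).den := by
    rw [Real.log_mul (by positivity) (by positivity), Real.log_pow]
    linarith
  have := (Real.log_lt_log_iff (by positivity)
    (by exact_mod_cast (harmonic n).den_pos)).1 key
  exact_mod_cast this

/-- The permutation of `Fin N` rotating the first `m` positions so that position `r` becomes
position `0` (the identity unless `r ≤ m ≤ N`). -/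
def blockRotate (N m r : ℕ) : Equiv.Perm (Fin N) :=
  if h : r ≤ m ∧ m ≤ N then
    { toFun := fun j =>
        ⟨if (j : ℕ) < r then j + (m - r) else if (j : ℕ) < m then j - r else j, by
          have := j.2; split_ifs <;> omega⟩
      invFun := fun j =>
        ⟨if (j : ℕ) < m - r then j + r else if (j : ℕ) < m then j - (m - r) else j, by
          have := j.2; split_ifs <;> omega⟩
      left_inv := fun j => by ext; dsimp only; split_ifs <;> omega
      right_inv := fun j => by ext; dsimp only; split_ifs <;> omega }
  else 1

theorem blockRotate_val {N m r : ℕ} (hr : r ≤ m) (hm : m ≤ N) (j : Fin N) :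
    (blockRotate N m r j : ℕ) =
      if (j : ℕ) < r then j + (m - r) else if (j : ℕ) < m then j - r else j := by
  simp [blockRotate, hr, hm]

/-- A function on `ℕ` attains its maximum over `range m` at a first place. -/
theorem exists_first_argmax (P : ℕ → ℝ) {m : ℕ} (hm : 0 < m) :
    ∃ r < m, (∀ l < m, P l ≤ P r) ∧ ∀ l < r, P l < P r := by
  classical
  have hex : ∃ r, r < m ∧ ∀ l < m, P l ≤ P r := by
    obtain ⟨r, hr, h⟩ := Finset.exists_max_image (Finset.range m) P ⟨0, by simpa using hm⟩
    exact ⟨r, by simpa using hr, fun l hl => h l (by simpa using hl)⟩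
  obtain ⟨hr, hmax⟩ := Nat.find_spec hex
  refine ⟨Nat.find hex, hr, hmax, fun l hl => (hmax l (hl.trans hr)).lt_of_ne fun he => ?_⟩
  exact Nat.find_min hex hl ⟨hl.trans hr, fun k hk => he ▸ hmax k hk⟩

section Numbering

open Finset Numbering

variable {α : Type*} [Fintype α]

/-- The sum of `c` over the first `m` elements of the numbering `f`. -/
def prefixSum (c : α → ℝ) (f : Numbering α) (m : ℕ) : ℝ := ∑ x, if (f x : ℕ) < m then c x else 0

theorem prefixSum_zero (c : α → ℝ) (f : Numbering α) : prefixSum c f 0 = 0 := by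
  simp [prefixSum]

theorem prefixSum_card (c : α → ℝ) (f : Numbering α) :
    prefixSum c f (Fintype.card α) = ∑ x, c x := by
  simp [prefixSum]

theorem prefixSum_rotate (c : α → ℝ) (f : Numbering α) {m r l : ℕ} (hr : r ≤ m)
    (hm : m ≤ Fintype.card α) (hl : l ≤ m) :
    prefixSum c (f.trans (blockRotate _ m r)) l =
      if r + l ≤ m then prefixSum c f (r + l) - prefixSum c f r
      else prefixSum c f m - prefixSum c f r + prefixSum c f (r + l - m) := by
  simp only [prefixSum, Equiv.trans_apply, blockRotate_val hr hm]
  split_ifs with h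
  · rw [← sum_sub_distrib]
    refine sum_congr rfl fun x _ => ?_
    split_ifs <;> first | omega | simp
  · rw [← sum_sub_distrib, ← sum_add_distrib]
    refine sum_congr rfl fun x _ => ?_
    split_ifs <;> first | omega | simp

theorem isPrefix_rotate {f : Numbering α} {X : Finset α} {r : ℕ} (hr : r ≤ #X) :
    IsPrefix (f.trans (blockRotate _ #X r)) X ↔ IsPrefix f X := by
  refine forall_congr' fun x => iff_congr Iff.rfl ?_
  rw [Equiv.trans_apply, blockRotate_val hr X.card_le_univ]
  split_ifs <;> omega

/-- The weight of a point of the cube, seen as a subset of the coordinates. -/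
noncomputable def pointWeight (X : Finset α) : ℝ := 1 / (#X * (Fintype.card α).choose #X)

/-- The nonzero points of the cube lying on the hyperplane with coefficients `c`. -/
noncomputable def planePoints (c : α → ℝ) : Finset (Finset α) := {X | ∑ x ∈ X, c x = 1}

theorem mem_planePoints {c : α → ℝ} {X : Finset α} : X ∈ planePoints c ↔ ∑ x ∈ X, c x = 1 := by
  simp [planePoints]

theorem card_pos_of_mem_planePoints {c : α → ℝ} {X : Finset α} (h : X ∈ planePoints c) :
    0 < #X := by
  rw [card_pos, nonempty_iff_ne_empty]
  rintro rfl
  simp [mem_planePoints] at h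

/-- The total weight of the points on the hyperplane with coefficients `c`. -/
noncomputable def planeWeight (c : α → ℝ) : ℝ := ∑ X ∈ planePoints c, pointWeight X

/-- The cycle lemma: rotating to start after the first maximum of the partial sums keeps all
proper partial sums below `1`. -/
theorem prefixSum_rotate_lt_one {c : α → ℝ} {f : Numbering α} {m r : ℕ}
    (hm : m ≤ Fintype.card α) (h1 : prefixSum c f m = 1) (hr : r < m)
    (hmax : ∀ l < m, prefixSum c f l ≤ prefixSum c f r)
    (hfirst : ∀ l < r, prefixSum c f l < prefixSum c f r) {l : ℕ} (hlm : l < m) :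
    prefixSum c (f.trans (blockRotate _ m r)) l < 1 := by
  rw [prefixSum_rotate c f hr.le hm hlm.le]
  split_ifs with h
  · rcases h.lt_or_eq with h | h
    · linarith [hmax _ h]
    · rw [h, h1]
      have := hfirst 0 (by omega)
      rw [prefixSum_zero] at this
      linarith
  · rw [h1]
    linarith [hfirst (r + l - m) (by omega)]

theorem val_eq_zero_of_isPrefix_singleton {f : Numbering α} {i : α} (h : IsPrefix f {i}) :
    (f i : ℕ) = 0 := by
  simpa using h i

theorem exists_int_prefixSum {c : α → ℝ} (hint : ∀ x, ∃ z : ℤ, c x = z) (f : Numbering α)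
    (m : ℕ) : ∃ z : ℤ, prefixSum c f m = z := by
  choose z hz using hint
  refine ⟨∑ x, if (f x : ℕ) < m then z x else 0, ?_⟩
  simp [prefixSum, hz]

theorem exists_isPrefix_card_eq (f : Numbering α) {m : ℕ} (hm : m ≤ Fintype.card α) :
    ∃ X : Finset α, #X = m ∧ IsPrefix f X := by
  have hcard : #({x | (f x : ℕ) < m} : Finset α) = m := by
    have : ({x | (f x : ℕ) < m} : Finset α).map f.toEmbedding =
        ({j | (j : ℕ) < m} : Finset (Fin (Fintype.card α))) := by
      ext j
      simp only [mem_map, mem_filter, mem_univ, true_and]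
      exact ⟨by rintro ⟨x, hx, rfl⟩; exact hx, fun h => ⟨f.symm j, by simpa using h, by simp⟩⟩
    rw [← card_map f.toEmbedding, this, Fin.card_filter_val_lt]
    omega
  exact ⟨_, hcard, fun x => by rw [hcard]; simp⟩

theorem one_div_choose_ge [Nonempty α] (k : ℕ) (hk : k ≤ Fintype.card α) :
    1 / ((Fintype.card α : ℝ) * 2 ^ Fintype.card α) ≤ 1 / (Fintype.card α).choose k := by
  have h1 : 1 ≤ Fintype.card α := Fintype.card_pos
  have hc : (0 : ℝ) < (Fintype.card α).choose k := by exact_mod_cast Nat.choose_pos hk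
  refine one_div_le_one_div_of_le hc ?_
  have : (Fintype.card α).choose k ≤ Fintype.card α * 2 ^ Fintype.card α :=
    (Nat.choose_le_two_pow _ _).trans (Nat.le_mul_of_pos_left _ h1)
  exact_mod_cast this

variable [DecidableEq α]

theorem prefixSum_succ (c : α → ℝ) (f : Numbering α) {i : α} {k : ℕ} (hi : (f i : ℕ) = k) :
    prefixSum c f (k + 1) = prefixSum c f k + c i := by
  have : c i = ∑ x, if x = i then c x else 0 := by simp
  rw [this, prefixSum, prefixSum, ← sum_add_distrib]
  refine sum_congr rfl fun x _ => ?_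
  by_cases hx : x = i
  · subst hx; simp [hi]
  · have : (f x : ℕ) ≠ k := fun h => hx (f.injective (Fin.ext (h.trans hi.symm)))
    have : (f x : ℕ) < k + 1 ↔ (f x : ℕ) < k := by omega
    simp [hx, this]

theorem prefixSum_of_isPrefix (c : α → ℝ) {f : Numbering α} {X : Finset α} (h : IsPrefix f X) :
    prefixSum c f #X = ∑ x ∈ X, c x := by
  simp only [prefixSum, ← h _, sum_ite_mem, univ_inter]

theorem card_prefixed_le_mul {X : Finset α} {G : Numbering α → Prop} [DecidablePred G]
    (h : ∀ f, IsPrefix f X → ∃ r < #X, G (f.trans (blockRotate _ #X r))) :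
    #(prefixed X) ≤ #X * #{f ∈ prefixed X | G f} := by
  have hsub : prefixed X ⊆ (range #X).biUnion fun r =>
      ({f ∈ prefixed X | G f}).image fun g => g.trans (blockRotate _ #X r).symm := by
    intro f hf
    rw [mem_prefixed] at hf
    obtain ⟨r, hr, hG⟩ := h f hf
    refine mem_biUnion.2 ⟨r, mem_range.2 hr, mem_image.2 ⟨f.trans (blockRotate _ #X r), ?_, ?_⟩⟩
    · rw [mem_filter, mem_prefixed, isPrefix_rotate hr.le]
      exact ⟨hf, hG⟩
    · ext; simp
  refine (card_le_card hsub).trans ?_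
  simpa using card_biUnion_le_card_mul (range #X) _ _ fun r _ => card_image_le

theorem mul_le_card_prefixed {X : Finset α} {G : Numbering α → Prop} [DecidablePred G]
    (h : ∀ f, IsPrefix f X → ∀ r < #X, ∀ s < #X, G (f.trans (blockRotate _ #X r)) →
      G (f.trans (blockRotate _ #X s)) → r = s) :
    #X * #{f ∈ prefixed X | G f} ≤ #(prefixed X) := by
  rw [show #X * #{f ∈ prefixed X | G f} = #(range #X ×ˢ {f ∈ prefixed X | G f}) by
    rw [card_product, card_range]]
  have key : ∀ (g : Numbering α) (r : ℕ),
      (g.trans (blockRotate _ #X r).symm).trans (blockRotate _ #X r) = g := by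
    intro g r; ext; simp
  have hpre : ∀ (g : Numbering α) (r : ℕ), r < #X → IsPrefix g X →
      IsPrefix (g.trans (blockRotate _ #X r).symm) X := by
    intro g r hr hg
    rw [← isPrefix_rotate hr.le, key]
    exact hg
  refine card_le_card_of_injOn (fun q => q.2.trans (blockRotate _ #X q.1).symm) ?_ ?_
  · rintro ⟨r, g⟩ hq
    simp only [coe_product, Set.mem_prod, mem_coe, mem_range, mem_filter, mem_prefixed] at hq ⊢
    exact hpre g r hq.1 hq.2.1
  · rintro ⟨r, g⟩ hq ⟨s, g'⟩ hq' heq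
    simp only [coe_product, Set.mem_prod, mem_coe, mem_range, mem_filter, mem_prefixed] at hq hq' heq
    have hrs : r = s := by
      refine h _ (hpre g r hq.1 hq.2.1) r hq.1 s hq'.1 ?_ ?_
      · rw [key]; exact hq.2.2
      · rw [heq, key]; exact hq'.2.2
    subst hrs
    rw [Prod.mk.injEq]
    exact ⟨rfl, by rw [← key g r, heq, key]⟩

theorem card_prefixed_div (X : Finset α) :
    (#(prefixed X) : ℝ) / (Fintype.card α).factorial = 1 / (Fintype.card α).choose #X := by
  have h := Nat.choose_mul_factorial_mul_factorial X.card_le_univ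
  have h' : ((Fintype.card α).factorial : ℝ) =
      (Fintype.card α).choose #X * #(prefixed X) := by
    rw [card_prefixed, ← h]; push_cast; ring
  have hp : (0 : ℝ) < #(prefixed X) := by rw [card_prefixed]; positivity
  have hc : (0 : ℝ) < (Fintype.card α).choose #X := by
    exact_mod_cast Nat.choose_pos X.card_le_univ
  rw [h']
  field_simp

theorem pointWeight_eq (X : Finset α) :
    pointWeight X = (#(prefixed X) : ℝ) / #X / (Fintype.card α).factorial := by
  rw [div_right_comm, card_prefixed_div, pointWeight, div_div, mul_comm]

open Classical in
theorem planeWeight_le_of_rotation {c : α → ℝ} {G : Finset α → Numbering α → Prop}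
    (hG : ∀ X f, G X f → ∀ l, 0 < l → l < #X → prefixSum c f l < 1)
    (hrot : ∀ X ∈ planePoints c, ∀ f, IsPrefix f X →
      ∃ r < #X, G X (f.trans (blockRotate _ #X r)))
    (B : Finset (Numbering α)) (hB : ∀ f ∈ B, ∀ X ∈ planePoints c, IsPrefix f X → ¬ G X f) :
    planeWeight c ≤ 1 - (#B : ℝ) / (Fintype.card α).factorial := by
  have hN : (0 : ℝ) < (Fintype.card α).factorial := by positivity
  have hlt : ∀ X ∈ planePoints c, ∀ Y ∈ planePoints c, ∀ f, IsPrefix f X → IsPrefix f Y →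
      G Y f → ¬ #X < #Y := by
    intro X hX Y _ f hfX _ hGY hlt
    have := hG Y f hGY #X (card_pos_of_mem_planePoints hX) hlt
    rw [prefixSum_of_isPrefix c hfX, mem_planePoints.1 hX] at this
    exact lt_irrefl _ this
  have hdisj : (planePoints c : Set (Finset α)).PairwiseDisjoint
      fun X => ({f ∈ prefixed X | G X f} : Finset (Numbering α)) := by
    intro X hX Y hY hne
    refine disjoint_left.2 fun f hfX hfY => hne ?_
    simp only [mem_filter, mem_prefixed] at hfX hfY
    have h1 := hlt X hX Y hY f hfX.1 hfY.1 hfY.2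
    have h2 := hlt Y hY X hX f hfY.1 hfX.1 hfX.2
    exact (hfX.1.subset_of_card_le_card hfY.1 (by omega)).antisymm
      (hfY.1.subset_of_card_le_card hfX.1 (by omega))
  have hcard : ∑ X ∈ planePoints c, #{f ∈ prefixed X | G X f} + #B ≤
      (Fintype.card α).factorial := by
    rw [← card_biUnion hdisj, ← card_union_of_disjoint, ← Fintype.card_numbering]
    · exact card_le_univ _
    · refine disjoint_left.2 fun f hf hfB => ?_
      obtain ⟨X, hX, hfX⟩ := mem_biUnion.1 hf
      rw [mem_filter, mem_prefixed] at hfX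
      exact hB f hfB X hX hfX.1 hfX.2
  have hle : planeWeight c ≤
      ∑ X ∈ planePoints c, (#{f ∈ prefixed X | G X f} : ℝ) / (Fintype.card α).factorial := by
    refine sum_le_sum fun X hX => ?_
    have hX0 : (0 : ℝ) < #X := by exact_mod_cast card_pos_of_mem_planePoints hX
    rw [pointWeight_eq]
    gcongr
    rw [div_le_iff₀' hX0]
    exact_mod_cast card_prefixed_le_mul (hrot X hX)
  refine hle.trans ?_
  rw [← sum_div, le_sub_iff_add_le, ← add_div, div_le_one hN]
  exact_mod_cast hcard

theorem planeWeight_le (c : α → ℝ) (B : Finset (Numbering α))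
    (hB : ∀ f ∈ B, ∀ X ∈ planePoints c, IsPrefix f X →
      ¬ ∀ l, 0 < l → l < #X → prefixSum c f l < 1) :
    planeWeight c ≤ 1 - (#B : ℝ) / (Fintype.card α).factorial := by
  refine planeWeight_le_of_rotation
    (G := fun X f => ∀ l, 0 < l → l < #X → prefixSum c f l < 1) (fun _ _ h => h) ?_ B hB
  intro X hX f hf
  have h1 := prefixSum_of_isPrefix c hf
  rw [mem_planePoints.1 hX] at h1
  obtain ⟨r, hr, hmax, hfirst⟩ :=
    exists_first_argmax (prefixSum c f) (card_pos_of_mem_planePoints hX)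
  exact ⟨r, hr, fun l _ hlm =>
    prefixSum_rotate_lt_one X.card_le_univ h1 hr hmax hfirst hlm⟩

theorem planeWeight_le_one (c : α → ℝ) : planeWeight c ≤ 1 := by
  simpa using planeWeight_le c ∅ (by simp)

theorem planeWeight_le_of_one_lt {c : α → ℝ} {i : α} (hi : 1 < c i) :
    planeWeight c ≤ 1 - 1 / (Fintype.card α).choose 1 := by
  have := planeWeight_le c (prefixed {i}) ?_
  · rwa [card_prefixed_div, card_singleton] at this
  intro f hf X hX hfX hgood
  rw [mem_prefixed] at hf
  have h1 := prefixSum_succ c f (val_eq_zero_of_isPrefix_singleton hf)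
  rw [prefixSum_zero, zero_add, zero_add] at h1
  have hX1 := prefixSum_of_isPrefix c hfX
  rw [mem_planePoints.1 hX] at hX1
  rcases (Nat.succ_le_of_lt (card_pos_of_mem_planePoints hX)).eq_or_lt with h | h
  · rw [← h] at hX1
    simp only [Nat.succ_eq_add_one, zero_add] at hX1
    linarith
  · linarith [hgood 1 one_pos h]

theorem planeWeight_le_of_pos_of_lt_one {c : α → ℝ} {i : α} (hi0 : 0 < c i) (hi1 : c i < 1) :
    planeWeight c ≤ 1 - 1 / (Fintype.card α).choose 1 := by
  have := planeWeight_le_of_rotation (c := c) (G := fun X f =>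
    (∀ l, 0 < l → l < #X → prefixSum c f l < 1) ∧ (f i : ℕ) ≠ 0) (fun _ _ h => h.1) ?_
    (prefixed {i}) ?_
  · rwa [card_prefixed_div, card_singleton] at this
  · intro X hX f hf
    have h1 := prefixSum_of_isPrefix c hf
    rw [mem_planePoints.1 hX] at h1
    have hX0 := card_pos_of_mem_planePoints hX
    obtain ⟨r, hr, hmax, hfirst⟩ := exists_first_argmax (prefixSum c f) hX0
    by_cases hir : (f i : ℕ) = r
    · have hstep := prefixSum_succ c f hir
      have hr1 : r + 1 = #X := by
        by_contra hne
        linarith [hmax (r + 1) (by omega)]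
      rw [hr1, h1] at hstep
      refine ⟨0, hX0, fun l _ hlm => ?_, ?_⟩
      · rw [prefixSum_rotate c f (Nat.zero_le _) X.card_le_univ hlm.le, zero_add, if_pos hlm.le,
          prefixSum_zero]
        linarith [hmax l hlm]
      · rw [Equiv.trans_apply, blockRotate_val (Nat.zero_le _) X.card_le_univ]
        have : r ≠ 0 := by
          rintro rfl
          rw [prefixSum_zero] at hstep
          linarith
        split_ifs <;> omega
    · refine ⟨r, hr, fun l _ hlm =>
        prefixSum_rotate_lt_one X.card_le_univ h1 hr hmax hfirst hlm, ?_⟩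
      rw [Equiv.trans_apply, blockRotate_val hr.le X.card_le_univ]
      split_ifs <;> omega
  · intro f hf X _ _ hG
    exact hG.2 (val_eq_zero_of_isPrefix_singleton (mem_prefixed.1 hf))

theorem planeWeight_le_of_sum_lt_one {c : α → ℝ} (hc : ∑ x, c x < 1) :
    planeWeight c ≤ 1 - 1 / (Fintype.card α).choose #{x | c x ≤ 0} := by
  have := planeWeight_le c (prefixed ({x | c x ≤ 0} : Finset α)) ?_
  · rwa [card_prefixed_div] at this
  intro f hf X hX hfX _
  rw [mem_prefixed] at hf
  rw [mem_planePoints] at hX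
  rcases le_total #X #{x | c x ≤ 0} with h | h
  · have hsub := hfX.subset_of_card_le_card hf h
    have : ∑ x ∈ X, c x ≤ 0 := sum_nonpos fun x hx => (mem_filter.1 (hsub hx)).2
    linarith
  · have hsub := hf.subset_of_card_le_card hfX h
    have : ∑ x ∈ X, c x ≤ ∑ x, c x := by
      refine sum_le_sum_of_subset_of_nonneg (subset_univ _) fun x _ hx => ?_
      by_contra! hneg
      exact hx (hsub (mem_filter.2 ⟨mem_univ _, hneg.le⟩))
    linarith

theorem card_prefixed_le_card_mul {X : Finset α} {i : α} (hi : i ∈ X) :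
    #(prefixed X) ≤ #{f ∈ prefixed X | (f i : ℕ) = 0} * Fintype.card α := by
  have h0 : 0 < Fintype.card α := Fintype.card_pos_iff.2 ⟨i⟩
  have hX0 : 0 < #X := card_pos.2 ⟨i, hi⟩
  rw [show #{f ∈ prefixed X | (f i : ℕ) = 0} * Fintype.card α =
      #({f ∈ prefixed X | (f i : ℕ) = 0} ×ˢ (univ : Finset (Fin (Fintype.card α)))) by
    rw [card_product, Finset.card_univ, Fintype.card_fin]]
  refine card_le_card_of_injOn
    (fun f => ((f.trans (Equiv.swap (f i) ⟨0, h0⟩) : Numbering α), f i)) ?_ ?_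
  · intro f hf
    rw [mem_coe, mem_prefixed] at hf
    simp only [coe_product, Set.mem_prod, mem_coe, mem_filter, mem_prefixed, mem_univ, and_true]
    refine ⟨fun x => ?_, by simp⟩
    rw [Equiv.trans_apply, hf x]
    have := (hf i).1 hi
    rw [Equiv.swap_apply_def]
    split_ifs with h1 h2
    · rw [h1]; simp [hX0, this]
    · rw [h2]; simp [hX0, this]
    · rfl
  · intro f _ g _ hfg
    simp only [Prod.mk.injEq] at hfg
    obtain ⟨h1, h2⟩ := hfg
    ext x
    have := DFunLike.congr_fun h1 x
    simp only [Equiv.trans_apply, h2] at this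
    rw [(Equiv.swap _ _).injective this]

theorem planeWeight_le_of_not_int {c : α → ℝ} (hc : ∀ x, c x ≤ 0 ∨ c x = 1)
    (hsum : 1 ≤ ∑ x, c x) {i : α} (hi : ∀ z : ℤ, c i ≠ z) :
    planeWeight c ≤ 1 - 1 / (Fintype.card α *
      (Fintype.card α).choose #(insert i ({x | c x = 1} : Finset α))) := by
  set O : Finset α := {x | c x = 1} with hO
  have hiO : i ∉ O := fun h => hi 1 (by simpa using (mem_filter.1 h).2)
  have hN : (0 : ℝ) < Fintype.card α := by exact_mod_cast Fintype.card_pos_iff.2 ⟨i⟩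
  have hB := planeWeight_le c {f ∈ prefixed (insert i O) | (f i : ℕ) = 0} ?_
  · refine hB.trans (sub_le_sub_left ?_ 1)
    rw [mul_comm, ← div_div, ← card_prefixed_div, div_right_comm]
    gcongr
    rw [div_le_iff₀ hN]
    exact_mod_cast card_prefixed_le_card_mul (mem_insert_self i O)
  intro f hf X hX hfX hgood
  rw [mem_filter, mem_prefixed] at hf
  rcases le_or_gt #X #(insert i O) with h | h
  · have hsub := hfX.subset_of_card_le_card hf.1 h
    have hiX : i ∈ X := (hfX i).2 (by rw [hf.2]; exact card_pos_of_mem_planePoints hX)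
    have hone : ∑ x ∈ X.erase i, c x = #(X.erase i) := by
      rw [card_eq_sum_ones, Nat.cast_sum]
      refine sum_congr rfl fun x hx => ?_
      rw [mem_erase] at hx
      have := (mem_insert.1 (hsub hx.2)).resolve_left hx.1
      simpa using (mem_filter.1 this).2
    have hs := mem_planePoints.1 hX
    rw [← add_sum_erase X c hiX, hone] at hs
    exact hi (1 - #(X.erase i)) (by push_cast; linarith)
  · have hlt := hgood _ (card_pos.2 ⟨i, mem_insert_self i O⟩) h
    rw [prefixSum_of_isPrefix c hf.1] at hlt
    have : ∑ x, c x ≤ ∑ x ∈ insert i O, c x := by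
      rw [← sum_sdiff (subset_univ (insert i O))]
      have : ∑ x ∈ univ \ insert i O, c x ≤ 0 := by
        refine sum_nonpos fun x hx => (hc x).resolve_right fun h1 => ?_
        exact (mem_sdiff.1 hx).2 (mem_insert_of_mem (mem_filter.2 ⟨mem_univ _, h1⟩))
      linarith
    linarith

open Classical in
theorem one_le_planeWeight {c : α → ℝ} (hint : ∀ x, ∃ z : ℤ, c x = z) (hle : ∀ x, c x ≤ 1)
    (hsum : 1 ≤ ∑ x, c x) : 1 ≤ planeWeight c := by
  have hN : (0 : ℝ) < (Fintype.card α).factorial := by positivity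
  have hnonpos : ∀ {f : Numbering α} {a b : ℕ}, prefixSum c f a < prefixSum c f b + 1 →
      prefixSum c f a ≤ prefixSum c f b := by
    intro f a b h
    obtain ⟨z, hz⟩ := exists_int_prefixSum hint f a
    obtain ⟨w, hw⟩ := exists_int_prefixSum hint f b
    rw [hz, hw] at h ⊢
    exact_mod_cast Int.lt_add_one_iff.1 (by exact_mod_cast h)
  set G : Finset α → Numbering α → Prop :=
    fun X f => ∀ l, 0 < l → l < #X → prefixSum c f l < 1 with hG
  have hcover : (univ : Finset (Numbering α)) ⊆
      (planePoints c).biUnion fun X => {f ∈ prefixed X | G X f} := by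
    intro f _
    have hex : ∃ m, 1 ≤ prefixSum c f m := ⟨_, by rwa [prefixSum_card]⟩
    have hspec := Nat.find_spec hex
    have hmin := fun {l} => Nat.find_min (m := l) hex
    have hmN : Nat.find hex ≤ Fintype.card α := Nat.find_le (by rwa [prefixSum_card])
    generalize Nat.find hex = m at hspec hmin hmN
    rcases m with _ | k
    · rw [prefixSum_zero] at hspec
      linarith
    have hstep := prefixSum_succ c f (i := f.symm ⟨k, by omega⟩) (k := k) (by simp)
    have hk : prefixSum c f k ≤ 0 := by
      have := hmin (Nat.lt_succ_self k)
      rw [← prefixSum_zero c f]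
      refine hnonpos ?_
      rw [prefixSum_zero]
      linarith
    obtain ⟨X, hXm, hfX⟩ := exists_isPrefix_card_eq f hmN
    refine mem_biUnion.2 ⟨X, mem_planePoints.2 ?_, ?_⟩
    · rw [← prefixSum_of_isPrefix c hfX, hXm]
      linarith [hle (f.symm ⟨k, by omega⟩)]
    · rw [mem_filter, mem_prefixed]
      refine ⟨hfX, fun l _ hl => ?_⟩
      simpa using hmin (hXm ▸ hl)
  have hcard : (Fintype.card α).factorial ≤
      ∑ X ∈ planePoints c, #{f ∈ prefixed X | G X f} := by
    rw [← Fintype.card_numbering, ← Finset.card_univ]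
    exact (card_le_card hcover).trans card_biUnion_le
  have hge : ∑ X ∈ planePoints c,
      (#{f ∈ prefixed X | G X f} : ℝ) / (Fintype.card α).factorial ≤ planeWeight c := by
    refine sum_le_sum fun X hX => ?_
    have hX0 : (0 : ℝ) < #X := by exact_mod_cast card_pos_of_mem_planePoints hX
    rw [pointWeight_eq]
    gcongr
    rw [le_div_iff₀' hX0]
    have huniq : ∀ f, IsPrefix f X → ∀ r s, s < #X → G X (f.trans (blockRotate _ #X r)) →
        G X (f.trans (blockRotate _ #X s)) → ¬ r < s := by
      intro f hf r s hs hGr hGs hrs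
      have h1 := prefixSum_of_isPrefix c hf
      rw [mem_planePoints.1 hX] at h1
      have hr1 := hGr (s - r) (by omega) (by omega)
      have hs1 := hGs (#X - (s - r)) (by omega) (by omega)
      rw [prefixSum_rotate c f (by omega) X.card_le_univ (by omega), if_pos (by omega),
        show r + (s - r) = s by omega] at hr1
      have hle : prefixSum c f s ≤ prefixSum c f r := hnonpos (by linarith)
      rw [prefixSum_rotate c f hs.le X.card_le_univ (by omega)] at hs1
      split_ifs at hs1 with hif
      · have hr0 : r = 0 := by omega
        subst hr0
        rw [show s + (#X - (s - 0)) = #X by omega, h1] at hs1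
        rw [prefixSum_zero] at hle
        linarith
      · rw [show s + (#X - (s - r)) - #X = r by omega, h1] at hs1
        linarith
    exact_mod_cast mul_le_card_prefixed fun f hf r hr s hs hGr hGs =>
      le_antisymm (not_lt.1 (huniq f hf s r hr hGs hGr)) (not_lt.1 (huniq f hf r s hs hGr hGs))
  refine le_trans ?_ hge
  rw [← sum_div, le_div_iff₀ hN, one_mul]
  exact_mod_cast hcard

/-- Stability: a hyperplane that is not of maximum weight is far from it. -/
theorem planeWeight_eq_one_or_le [Nonempty α] (c : α → ℝ) :
    planeWeight c = 1 ∨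
      planeWeight c ≤ 1 - 1 / ((Fintype.card α : ℝ) * 2 ^ Fintype.card α) := by
  have h1 : 1 ≤ Fintype.card α := Fintype.card_pos
  by_cases hgt : ∃ i, 1 < c i
  · obtain ⟨i, hi⟩ := hgt
    exact .inr ((planeWeight_le_of_one_lt hi).trans (sub_le_sub_left (one_div_choose_ge _ h1) 1))
  by_cases hfrac : ∃ i, 0 < c i ∧ c i < 1
  · obtain ⟨i, hi0, hi1⟩ := hfrac
    exact .inr ((planeWeight_le_of_pos_of_lt_one hi0 hi1).trans
      (sub_le_sub_left (one_div_choose_ge _ h1) 1))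
  by_cases hsum : ∑ x, c x < 1
  · exact .inr ((planeWeight_le_of_sum_lt_one hsum).trans
      (sub_le_sub_left (one_div_choose_ge _ (card_le_univ _)) 1))
  push Not at hgt hfrac hsum
  by_cases hint : ∀ x, ∃ z : ℤ, c x = z
  · exact .inl ((planeWeight_le_one c).antisymm (one_le_planeWeight hint hgt hsum))
  push Not at hint
  obtain ⟨i, hi⟩ := hint
  refine .inr ((planeWeight_le_of_not_int (fun x => ?_) hsum hi).trans (sub_le_sub_left ?_ 1))
  · rcases le_or_gt (c x) 0 with h | h
    · exact .inl h
    · exact .inr ((hgt x).antisymm (hfrac x h))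
  · have hc : (0 : ℝ) < (Fintype.card α).choose #(insert i ({x | c x = 1} : Finset α)) := by
      exact_mod_cast Nat.choose_pos (card_le_univ _)
    refine one_div_le_one_div_of_le (mul_pos (by exact_mod_cast h1) hc) ?_
    gcongr
    exact_mod_cast Nat.choose_le_two_pow _ _

end Numbering

section Cover

open Finset

variable {α : Type*} [Fintype α]

theorem pointWeight_nonneg (X : Finset α) : 0 ≤ pointWeight X := by
  rw [pointWeight]; positivity

theorem le_pointWeight {X : Finset α} (hX : X.Nonempty) :
    1 / ((Fintype.card α : ℝ) * 2 ^ Fintype.card α) ≤ pointWeight X := by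
  have hc : 0 < (Fintype.card α).choose #X := Nat.choose_pos X.card_le_univ
  have hX0 : 0 < #X := card_pos.2 hX
  refine one_div_le_one_div_of_le (by exact_mod_cast Nat.mul_pos hX0 hc) ?_
  exact_mod_cast Nat.mul_le_mul X.card_le_univ (Nat.choose_le_two_pow _ _)

theorem sum_pointWeight : ∑ X : Finset α, pointWeight X = harmonicR (Fintype.card α) := by
  have h := sum_powerset_apply_card
    (fun m => 1 / ((m : ℝ) * (Fintype.card α).choose m)) (x := (univ : Finset α))
  rw [powerset_univ] at h
  simp only [pointWeight, h, Finset.card_univ, sum_range_succ', harmonicR]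
  simp only [Nat.cast_zero, zero_mul, div_zero, smul_zero, add_zero, nsmul_eq_mul]
  refine sum_congr rfl fun i hi => ?_
  have : (0 : ℝ) < (Fintype.card α).choose (i + 1) := by
    exact_mod_cast Nat.choose_pos (mem_range.1 hi)
  push_cast
  field_simp

open Classical in
theorem sum_map_planeWeight (C : Multiset (α → ℝ)) :
    (C.map planeWeight).sum =
      ∑ X, pointWeight X * (C.filter fun c => X ∈ planePoints c).card := by
  induction C using Multiset.induction_on with
  | empty => simp
  | cons c C ih =>
    rw [Multiset.map_cons, Multiset.sum_cons, ih, planeWeight, ← univ_inter (planePoints c),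
      ← sum_ite_mem, ← sum_add_distrib]
    refine sum_congr rfl fun X _ => ?_
    rw [Multiset.filter_cons]
    split_ifs <;> simp
    ring

theorem sum_map_planeWeight_le_card (C : Multiset (α → ℝ)) :
    (C.map planeWeight).sum ≤ C.card := by
  classical
  simpa using Multiset.sum_le_card_nsmul (C.map planeWeight) 1 (by simp [planeWeight_le_one])

open Classical in
/-- The size of a `k`-cover either equals the fractional bound or exceeds it by a fixed amount. -/
theorem card_eq_or_le_card [Nonempty α] {k : ℕ} {C : Multiset (α → ℝ)}
    (hC : ∀ X : Finset α, X.Nonempty → k ≤ (C.filter fun c => X ∈ planePoints c).card) :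
    (C.card : ℝ) = k * harmonicR (Fintype.card α) ∨
      k * harmonicR (Fintype.card α) + 1 / ((Fintype.card α : ℝ) * 2 ^ Fintype.card α) ≤
        C.card := by
  have hsum := sum_map_planeWeight C
  have hterm : ∀ X : Finset α, pointWeight X * k ≤
      pointWeight X * (C.filter fun c => X ∈ planePoints c).card := by
    intro X
    rcases X.eq_empty_or_nonempty with rfl | hX
    · simp [pointWeight]
    · exact mul_le_mul_of_nonneg_left (by exact_mod_cast hC X hX) (pointWeight_nonneg X)
  have hk : ∑ X : Finset α, pointWeight X * k = k * harmonicR (Fintype.card α) := by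
    rw [← sum_mul, sum_pointWeight, mul_comm]
  have hge : k * harmonicR (Fintype.card α) ≤ (C.map planeWeight).sum := by
    rw [hsum, ← hk]
    exact sum_le_sum fun X _ => hterm X
  by_cases hall : ∀ c ∈ C, planeWeight c = 1
  · have hcard : (C.map planeWeight).sum = C.card := by
      rw [Multiset.map_congr rfl hall]; simp
    by_cases hX : ∃ X : Finset α, X.Nonempty ∧ k < (C.filter fun c => X ∈ planePoints c).card
    · obtain ⟨X, hX, hlt⟩ := hX
      right
      have hlt' : pointWeight X * k + pointWeight X ≤
          pointWeight X * (C.filter fun c => X ∈ planePoints c).card := by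
        rw [← mul_add_one]
        exact mul_le_mul_of_nonneg_left (by exact_mod_cast hlt) (pointWeight_nonneg X)
      rw [← hcard, hsum, ← hk, ← add_sum_erase _ _ (mem_univ X),
        ← add_sum_erase univ (fun X => pointWeight X * _) (mem_univ X)]
      have := sum_le_sum fun Y (_ : Y ∈ univ.erase X) => hterm Y
      linarith [le_pointWeight hX]
    · push Not at hX
      left
      rw [← hcard, hsum, ← hk]
      refine sum_congr rfl fun X _ => ?_
      rcases X.eq_empty_or_nonempty with rfl | hne
      · simp [pointWeight]
      · rw [(hX X hne).antisymm (hC X hne)]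
  · push Not at hall
    obtain ⟨c, hc, hne⟩ := hall
    right
    obtain ⟨C, rfl⟩ := Multiset.exists_cons_of_mem hc
    have hstab := (planeWeight_eq_one_or_le c).resolve_left hne
    rw [Multiset.map_cons, Multiset.sum_cons] at hge
    rw [Multiset.card_cons]
    push_cast
    linarith [sum_map_planeWeight_le_card C]

end Cover

theorem exists_card_eq_coverNumber (n k : ℕ) : ∃ C : Multiset (Fin n → ℝ),
    C.card = coverNumber n k ∧ ∀ x : Fin n → ℝ, (∀ i, x i = 0 ∨ x i = 1) → x ≠ 0 →
      open scoped Classical in k ≤ (C.filter fun c => ∑ i, c i * x i = 1).card := by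
  classical
  refine Nat.sInf_mem (s := {m | ∃ C : Multiset (Fin n → ℝ), Multiset.card C = m ∧
    ∀ x : Fin n → ℝ, (∀ i, x i = 0 ∨ x i = 1) → x ≠ 0 →
      k ≤ Multiset.card (C.filter (fun c => ∑ i, c i * x i = 1))})
    ⟨_, ∑ i, Multiset.replicate k (Pi.single i 1), rfl, fun x hx hne => ?_⟩
  obtain ⟨i, hi⟩ := Function.ne_iff.1 hne
  have hle : Multiset.replicate k (Pi.single i (1 : ℝ)) ≤
      ∑ i, Multiset.replicate k (Pi.single i (1 : ℝ) : Fin n → ℝ) :=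
    Finset.single_le_sum (f := fun i => Multiset.replicate k (Pi.single i (1 : ℝ) : Fin n → ℝ))
      (fun _ _ => zero_le) (Finset.mem_univ i)
  refine le_trans (le_of_eq ?_) (Multiset.card_le_card (Multiset.filter_le_filter _ hle))
  rw [Multiset.filter_eq_self.2, Multiset.card_replicate]
  intro c hc
  rw [Multiset.eq_of_mem_replicate hc]
  simpa [Pi.single_apply] using (hx i).resolve_left hi

theorem coverNumber_eq_or_le {n : ℕ} (hn : 0 < n) (k : ℕ) :
    (coverNumber n k : ℝ) = k * harmonicR n ∨
      k * harmonicR n + 1 / ((n : ℝ) * 2 ^ n) ≤ coverNumber n k := by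
  classical
  have : Nonempty (Fin n) := ⟨⟨0, hn⟩⟩
  obtain ⟨C, hcard, hC⟩ := exists_card_eq_coverNumber n k
  rw [← hcard]
  have h := card_eq_or_le_card (k := k) (C := C) fun X hX => ?_
  · simpa only [Fintype.card_fin] using h
  · obtain ⟨j, hj⟩ := hX
    have := hC (fun i => if i ∈ X then 1 else 0) (fun i => by split_ifs <;> simp)
      (Function.ne_iff.2 ⟨j, by simp [hj]⟩)
    simpa [mem_planePoints] using this

theorem harmonicR_eq_harmonic (n : ℕ) : harmonicR n = (harmonic n : ℚ) := by
  simp [harmonicR, harmonic]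

/-- There are arbitrarily large multiples of a rational lying just below an integer. -/
theorem exists_mul_eq_sub_one_div_den (q : ℚ) (m : ℕ) :
    ∃ k : ℕ, m < k ∧ ∃ z : ℤ, (k : ℚ) * q = z - 1 / q.den := by
  have hD : (0 : ℤ) < q.den := by exact_mod_cast q.den_pos
  have hcop : IsCoprime q.num (q.den : ℤ) :=
    Int.isCoprime_iff_gcd_eq_one.2 (by simpa [Int.gcd] using q.reduced)
  obtain ⟨u, v, huv⟩ := hcop
  have hpos : 0 ≤ |u| + m + 1 := by positivity
  have hk : (m : ℤ) < -u + (|u| + m + 1) * q.den := by nlinarith [le_abs_self u]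
  refine ⟨(-u + (|u| + m + 1) * q.den).toNat, by omega, v + (|u| + m + 1) * q.num, ?_⟩
  have hcast : (((-u + (|u| + m + 1) * q.den).toNat : ℕ) : ℚ) =
      ((-u + (|u| + m + 1) * q.den : ℤ) : ℚ) := by
    exact_mod_cast Int.toNat_of_nonneg (by omega)
  have hD' : (q.den : ℚ) ≠ 0 := by exact_mod_cast q.den_ne_zero
  have huv' : (u : ℚ) * q.num + v * q.den = 1 := by exact_mod_cast huv
  rw [hcast]
  nth_rewrite 2 [← Rat.num_div_den q]
  push_cast
  field_simp
  linear_combination -huv'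

theorem infinitely_many_k_exceed_lower_bound :
    ∃ N : ℕ, ∀ n : ℕ, N ≤ n →
      {k : ℕ | 2 ≤ k ∧
        (⌈(k : ℝ) * harmonicR n⌉ + 1 : ℤ) ≤ (coverNumber n k : ℤ)}.Infinite := by
  obtain ⟨N, hN⟩ := Filter.eventually_atTop.1 eventually_mul_two_pow_lt_harmonic_den
  refine ⟨N + 1, fun n hn => Set.infinite_of_forall_exists_gt fun m => ?_⟩
  have hden := hN n (by omega)
  have hn0 : 0 < n := by omega
  obtain ⟨k, hk, z, hz⟩ := exists_mul_eq_sub_one_div_den (harmonic n) (m + 1)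
  refine ⟨k, ⟨by omega, ?_⟩, by omega⟩
  have hz' : (k : ℝ) * harmonicR n = z - 1 / (harmonic n).den := by
    rw [harmonicR_eq_harmonic]
    have := congrArg (Rat.cast : ℚ → ℝ) hz
    push_cast at this
    exact this
  have hpos : 0 < n * 2 ^ n := by positivity
  have hlt : (1 : ℝ) / (harmonic n).den < 1 / (n * 2 ^ n) :=
    one_div_lt_one_div_of_lt (by exact_mod_cast hpos) (by exact_mod_cast hden)
  have hlt1 : (1 : ℝ) / (harmonic n).den < 1 := by
    rw [div_lt_one (by exact_mod_cast (harmonic n).den_pos)]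
    exact_mod_cast lt_of_le_of_lt hpos hden
  have hpos' : (0 : ℝ) < 1 / (harmonic n).den :=
    one_div_pos.2 (by exact_mod_cast (harmonic n).den_pos)
  have hceil : ⌈(k : ℝ) * harmonicR n⌉ = z := by
    rw [Int.ceil_eq_iff, hz']
    constructor <;> linarith
  rw [hceil]
  rcases coverNumber_eq_or_le hn0 k with h | h
  · rw [hz'] at h
    have h1 : (coverNumber n k : ℤ) < z := by
      have : ((coverNumber n k : ℤ) : ℝ) < z := by push_cast; linarith
      exact_mod_cast this
    have h2 : z - 1 < (coverNumber n k : ℤ) := by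
      have : ((z - 1 : ℤ) : ℝ) < (coverNumber n k : ℤ) := by push_cast; linarith
      exact_mod_cast this
    omega
  · rw [hz'] at h
    have : (z : ℝ) < (coverNumber n k : ℤ) := by push_cast; linarith
    exact_mod_cast this
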